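/- arXiv:0812.0210 — 2 statements merged into one kernel-verified Lean document; each statement's English description precedes it below -/
import Mathlib

section
/- Let d₁ ≥ 1, d₂ ≥ 2, and let a, b : ℝ^{d₁} × ℝ^{d₂-1} → ℂ be Schwartz functions whose supports are contained in the closed cone {(ξ,η') : |η'| ≤ |ξ|}. Let C(s,y) = Σ_{n≥0} (−1)^n s^n y^{2n}/(2n)! and S(s,y) = Σ_{n≥0} (−1)^n s^n y^{2n+1}/(2n+1)! (so that for s > 0, C(s,y) = cos(√s·y) and S(s,y) = sin(√s·y)/√s). Define u : ℝ^{d₁} × ℝ × ℝ^{d₂-1} → ℂ by u(x, y₁, y') = (2π)^{−(d₁+d₂−1)/2} ∬ e^{i(ξ·x + η'·y')} [ C(|ξ|²−|η'|², y₁)·a(ξ,η') + S(|ξ|²−|η'|², y₁)·b(ξ,η') ] dξ dη'. Then u is a smooth function on ℝ^{d₁+d₂} satisfying ∂²_{y₁} u = Δ_x u − Δ_{y'} u everywhere and, for all (x, y'), u(x, 0, y') = (2π)^{−(d₁+d₂−1)/2} ∬ e^{i(ξ·x + η'·y')} a(ξ,η') dξ dη' and ∂_{y₁}u(x, 0, y')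 = (2π)^{−(d₁+d₂−1)/2} ∬ e^{i(ξ·x + η'·y')} b(ξ,η') dξ dη'. -/
open MeasureTheory RealInnerProductSpace

section WaveSynthesis

theorem hasDerivAt_mul_sinc (r t : ℝ) :
    HasDerivAt (fun t => t * Real.sinc (r * t)) (Real.cos (r * t)) t := by
  by_cases hr : r = 0
  · simpa [hr] using hasDerivAt_id' t
  · have h (t : ℝ) : t * Real.sinc (r * t) = Real.sin (r * t) / r := by
      by_cases ht : t = 0
      · simp [ht]
      · rw [Real.sinc_of_ne_zero (mul_ne_zero hr ht)]
        field_simp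
    simp_rw [h]
    convert! ((((hasDerivAt_id t).const_mul r).sin).div_const r) using 1
    simp [hr]

theorem hasDerivAt_cos_mul (r t : ℝ) :
    HasDerivAt (fun t => Real.cos (r * t)) (-(r ^ 2 * (t * Real.sinc (r * t)))) t := by
  convert! ((hasDerivAt_id t).const_mul r).cos using 1
  by_cases h : r * t = 0
  · rcases mul_eq_zero.1 h with h | h <;> simp [h]
  · rw [Real.sinc_of_ne_zero h]
    have h1 := left_ne_zero_of_mul h
    have h2 := right_ne_zero_of_mul h
    simp
    field_simp

theorem tsum_cos_sqrt {s : ℝ} (hs : 0 ≤ s) (y : ℝ) :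
    ∑' n : ℕ, (-1) ^ n * s ^ n * y ^ (2 * n) / (Nat.factorial (2 * n)) =
      Real.cos (√s * y) := by
  rw [Real.cos_eq_tsum]
  refine tsum_congr fun n => ?_
  rw [mul_pow, pow_mul √s, Real.sq_sqrt hs, mul_assoc]

theorem tsum_sin_sqrt {s : ℝ} (hs : 0 ≤ s) (y : ℝ) :
    ∑' n : ℕ, (-1) ^ n * s ^ n * y ^ (2 * n + 1) / (Nat.factorial (2 * n + 1)) =
      y * Real.sinc (√s * y) := by
  by_cases h : √s * y = 0
  · rcases mul_eq_zero.1 h with h | h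
    · rw [Real.sqrt_eq_zero hs] at h
      rw [tsum_eq_single 0 (fun n hn => by simp [h, hn])]
      simp [h]
    · simp [h]
  · have h1 := left_ne_zero_of_mul h
    have h2 := right_ne_zero_of_mul h
    have : y * Real.sinc (√s * y) = Real.sin (√s * y) / √s := by
      rw [Real.sinc_of_ne_zero h]
      field_simp
    rw [this, Real.sin_eq_tsum, ← tsum_div_const]
    refine tsum_congr fun n => ?_
    rw [mul_pow, pow_succ √s, pow_mul √s, Real.sq_sqrt hs]
    field_simp

/-- Continuous functions all of whose polynomial moments are integrable. -/
def HasMoments {P E : Type*} [NormedAddCommGroup P] [NormedAddCommGroup E] [MeasurableSpace P]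
    (μ : Measure P) (f : P → E) : Prop :=
  Continuous f ∧ ∀ k : ℕ, Integrable (fun p => ‖p‖ ^ k * ‖f p‖) μ

namespace HasMoments

variable {P E E' : Type*} [NormedAddCommGroup P] [NormedAddCommGroup E] [NormedAddCommGroup E']
  [MeasurableSpace P] [BorelSpace P] {μ : Measure P}

theorem of_norm_le {f : P → E'} {g : P → E}
    (hg : HasMoments μ g) (hf : Continuous f) (K : ℝ) (j : ℕ)
    (h : ∀ p, ‖f p‖ ≤ K * (‖p‖ ^ j * ‖g p‖)) : HasMoments μ f := by
  refine ⟨hf, fun k => ((hg.2 (k + j)).const_mul K).mono'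
    (Continuous.aestronglyMeasurable (by fun_prop)) (.of_forall fun p => ?_)⟩
  rw [norm_mul, norm_norm, norm_pow, norm_norm]
  calc ‖p‖ ^ k * ‖f p‖ ≤ ‖p‖ ^ k * (K * (‖p‖ ^ j * ‖g p‖)) := by gcongr; exact h p
    _ = K * (‖p‖ ^ (k + j) * ‖g p‖) := by ring

theorem integrable [SecondCountableTopology P] {f : P → E} (hf : HasMoments μ f) :
    Integrable f μ := by
  have h := hf.2 0
  simp only [pow_zero, one_mul] at h
  exact (integrable_norm_iff hf.1.aestronglyMeasurable).1 h

theorem add {f g : P → E} (hf : HasMoments μ f) (hg : HasMoments μ g) :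
    HasMoments μ (fun p => f p + g p) := by
  have hfg : Continuous fun p => f p + g p := hf.1.add hg.1
  refine ⟨hfg, fun k => ((hf.2 k).add (hg.2 k)).mono'
    (Continuous.aestronglyMeasurable (by fun_prop)) (.of_forall fun p => ?_)⟩
  rw [norm_mul, norm_norm, norm_pow, norm_norm, Pi.add_apply, ← mul_add]
  gcongr
  exact norm_add_le _ _

theorem neg {f : P → E} (hf : HasMoments μ f) : HasMoments μ (fun p => -f p) :=
  hf.of_norm_le hf.1.neg 1 0 (by simp)

theorem sub {f g : P → E} (hf : HasMoments μ f) (hg : HasMoments μ g) :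
    HasMoments μ (fun p => f p - g p) := by
  simpa only [sub_eq_add_neg] using hf.add hg.neg

theorem apply {Q : Type*} [NormedAddCommGroup Q] [NormedSpace ℝ Q] [NormedSpace ℝ E]
    {f : P → Q →L[ℝ] E} (hf : HasMoments μ f) (v : Q) :
    HasMoments μ (fun p => f p v) :=
  hf.of_norm_le (hf.1.clm_apply continuous_const) ‖v‖ 0 fun p => by
    simpa [mul_comm] using (f p).le_opNorm v

end HasMoments

variable {P Q E : Type*} [NormedAddCommGroup P] [NormedSpace ℝ P]
  [NormedAddCommGroup Q] [NormedSpace ℝ Q] [NormedAddCommGroup E] [NormedSpace ℂ E]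

/-- The plane wave `exp (i ℓ(p)(q)) cos (r(p) π(q))`. -/
noncomputable def cosWave (ℓ : P →L[ℝ] Q →L[ℝ] ℝ) (π : Q →L[ℝ] ℝ) (r : P → ℝ) (p : P) (q : Q) :
    ℂ :=
  Complex.exp (Complex.I * (ℓ p q : ℝ)) * (Real.cos (r p * π q) : ℝ)

/-- The plane wave `exp (i ℓ(p)(q)) sin (r(p) π(q)) / r(p)`, extended continuously to
`r(p) = 0`. -/
noncomputable def sincWave (ℓ : P →L[ℝ] Q →L[ℝ] ℝ) (π : Q →L[ℝ] ℝ) (r : P → ℝ) (p : P) (q : Q) :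
    ℂ :=
  Complex.exp (Complex.I * (ℓ p q : ℝ)) * (π q * Real.sinc (r p * π q) : ℝ)

/-- The differential of `q ↦ cosWave ℓ π r p q • a p + sincWave ℓ π r p q • b p` is again of this
form; this is its cosine amplitude. -/
noncomputable def cosAmplitude [NormedSpace ℝ E] (ℓ : P →L[ℝ] Q →L[ℝ] ℝ) (π : Q →L[ℝ] ℝ)
    (a b : P → E) (p : P) : Q →L[ℝ] E :=
  (ℓ p).smulRight (Complex.I • a p) + π.smulRight (b p)

/-- The sine amplitude of the differential of
`q ↦ cosWave ℓ π r p q • a p + sincWave ℓ π r p q • b p`. -/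
noncomputable def sincAmplitude [NormedSpace ℝ E] (ℓ : P →L[ℝ] Q →L[ℝ] ℝ) (π : Q →L[ℝ] ℝ)
    (r : P → ℝ) (a b : P → E) (p : P) : Q →L[ℝ] E :=
  (ℓ p).smulRight (Complex.I • b p) - π.smulRight ((r p ^ 2) • a p)

/-- Superposition of the waves `cosWave` and `sincWave` with amplitudes `a` and `b`. -/
noncomputable def waveSynthesis [NormedSpace ℝ E] [MeasurableSpace P] (μ : Measure P)
    (ℓ : P →L[ℝ] Q →L[ℝ] ℝ) (π : Q →L[ℝ] ℝ) (r : P → ℝ) (a b : P → E) (q : Q) : E :=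
  ∫ p, (cosWave ℓ π r p q • a p + sincWave ℓ π r p q • b p) ∂μ

section Waves

variable (ℓ : P →L[ℝ] Q →L[ℝ] ℝ) (π : Q →L[ℝ] ℝ) (r : P → ℝ) (p : P) (q : Q)

theorem hasFDerivAt_exp_I_mul (L : Q →L[ℝ] ℝ) (q : Q) :
    HasFDerivAt (fun q => Complex.exp (Complex.I * (L q : ℝ)))
      (L.smulRight (Complex.exp (Complex.I * (L q : ℝ)) * Complex.I)) q := by
  convert! ((Complex.ofRealCLM.hasFDerivAt.comp q L.hasFDerivAt).const_mul Complex.I).cexp using 1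
  ext v
  simp
  ring

theorem hasFDerivAt_cosWave :
    HasFDerivAt (cosWave ℓ π r p) ((ℓ p).smulRight (cosWave ℓ π r p q * Complex.I) -
      π.smulRight ((r p ^ 2 : ℝ) * sincWave ℓ π r p q)) q := by
  have h := (hasFDerivAt_exp_I_mul (ℓ p) q).mul (Complex.ofRealCLM.hasFDerivAt.comp q
    ((hasDerivAt_cos_mul (r p) (π q)).comp_hasFDerivAt q π.hasFDerivAt))
  convert! h using 1
  ext v
  simp [cosWave, sincWave]
  ring

theorem hasFDerivAt_sincWave :
    HasFDerivAt (sincWave ℓ π r p) ((ℓ p).smulRight (sincWave ℓ π r p q * Complex.I) +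
      π.smulRight (cosWave ℓ π r p q)) q := by
  have h := (hasFDerivAt_exp_I_mul (ℓ p) q).mul (Complex.ofRealCLM.hasFDerivAt.comp q
    ((hasDerivAt_mul_sinc (r p) (π q)).comp_hasFDerivAt q π.hasFDerivAt))
  convert! h using 1
  ext v
  simp [cosWave, sincWave]
  ring

theorem hasFDerivAt_cosWave_smul_add_sincWave_smul [NormedSpace ℝ E] [IsScalarTower ℝ ℂ E]
    (a b : P → E) :
    HasFDerivAt (fun q => cosWave ℓ π r p q • a p + sincWave ℓ π r p q • b p)
      (cosWave ℓ π r p q • cosAmplitude ℓ π a b p +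
        sincWave ℓ π r p q • sincAmplitude ℓ π r a b p) q := by
  have h := ((hasFDerivAt_cosWave ℓ π r p q).smul_const (a p)).add
    ((hasFDerivAt_sincWave ℓ π r p q).smul_const (b p))
  convert! h using 1
  ext v
  simp only [cosAmplitude, sincAmplitude, add_apply,
    sub_apply, smul_apply,
    ContinuousLinearMap.smulRight_apply, ← Complex.coe_smul, ← algebraMap_smul ℂ (_ : ℝ) (_ : E),
    Complex.coe_algebraMap, smul_eq_mul]
  push_cast
  module

theorem norm_cosWave_le : ‖cosWave ℓ π r p q‖ ≤ 1 := by
  rw [cosWave, norm_mul, mul_comm Complex.I, Complex.norm_exp_ofReal_mul_I, one_mul,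
    Complex.norm_real]
  exact Real.abs_cos_le_one _

theorem norm_sincWave_le : ‖sincWave ℓ π r p q‖ ≤ |π q| := by
  rw [sincWave, norm_mul, mul_comm Complex.I, Complex.norm_exp_ofReal_mul_I, one_mul,
    Complex.norm_real, norm_mul]
  exact mul_le_of_le_one_right (abs_nonneg _) (Real.abs_sinc_le_one _)

theorem continuous_cosWave {r : P → ℝ} (hr : Continuous r) :
    Continuous fun p => cosWave ℓ π r p q := by
  unfold cosWave
  fun_prop

theorem continuous_sincWave {r : P → ℝ} (hr : Continuous r) :
    Continuous fun p => sincWave ℓ π r p q := by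
  have := Real.continuous_sinc
  unfold sincWave
  fun_prop

theorem continuous_cosWave_smul_add_sincWave_smul {a b : P → E} {r : P → ℝ} (ha : Continuous a)
    (hb : Continuous b) (hr : Continuous r) :
    Continuous fun p => cosWave ℓ π r p q • a p + sincWave ℓ π r p q • b p :=
  ((continuous_cosWave ℓ π q hr).smul ha).add ((continuous_sincWave ℓ π q hr).smul hb)

theorem norm_cosWave_smul_add_sincWave_smul_le (a b : P → E) :
    ‖cosWave ℓ π r p q • a p + sincWave ℓ π r p q • b p‖ ≤ ‖a p‖ + |π q| * ‖b p‖ := by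
  refine (norm_add_le _ _).trans ?_
  rw [norm_smul, norm_smul]
  gcongr
  · exact mul_le_of_le_one_left (norm_nonneg _) (norm_cosWave_le ℓ π r p q)
  · exact norm_sincWave_le ℓ π r p q

end Waves

namespace HasMoments

variable [NormedSpace ℝ E] [MeasurableSpace P] [BorelSpace P] {μ : Measure P}

theorem cosAmplitude {a b : P → E} (ha : HasMoments μ a) (hb : HasMoments μ b)
    (ℓ : P →L[ℝ] Q →L[ℝ] ℝ) (π : Q →L[ℝ] ℝ) : HasMoments μ (cosAmplitude ℓ π a b) := by
  refine HasMoments.add (ha.of_norm_le ?_ ‖ℓ‖ 1 fun p => ?_) (hb.of_norm_le ?_ ‖π‖ 0 fun p => ?_)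
  · exact isBoundedBilinearMap_smulRight.continuous.comp
      (ℓ.continuous.prodMk (ha.1.const_smul Complex.I))
  · rw [ContinuousLinearMap.norm_smulRight_apply, norm_smul, Complex.norm_I, one_mul, pow_one,
      ← mul_assoc]
    gcongr
    exact ℓ.le_opNorm p
  · exact isBoundedBilinearMap_smulRight.continuous.comp (continuous_const.prodMk hb.1)
  · rw [ContinuousLinearMap.norm_smulRight_apply, pow_zero, one_mul]

theorem sincAmplitude {a b : P → E} (ha : HasMoments μ a) (hb : HasMoments μ b)
    (ℓ : P →L[ℝ] Q →L[ℝ] ℝ) (π : Q →L[ℝ] ℝ) {r : P → ℝ} (hr : Continuous r)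
    (hr' : ∀ p, |r p| ≤ ‖p‖) : HasMoments μ (sincAmplitude ℓ π r a b) := by
  refine HasMoments.sub (hb.of_norm_le ?_ ‖ℓ‖ 1 fun p => ?_) (ha.of_norm_le ?_ ‖π‖ 2 fun p => ?_)
  · exact isBoundedBilinearMap_smulRight.continuous.comp
      (ℓ.continuous.prodMk (hb.1.const_smul Complex.I))
  · rw [ContinuousLinearMap.norm_smulRight_apply, norm_smul, Complex.norm_I, one_mul, pow_one,
      ← mul_assoc]
    gcongr
    exact ℓ.le_opNorm p
  · exact isBoundedBilinearMap_smulRight.continuous.comp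
      (continuous_const.prodMk ((hr.pow 2).smul ha.1))
  · rw [ContinuousLinearMap.norm_smulRight_apply, norm_smul, norm_pow]
    gcongr
    exact hr' p

end HasMoments

section Synthesis

variable [MeasurableSpace P] [BorelSpace P]
  [SecondCountableTopology P] {μ : Measure P} {a b : P → E} {r : P → ℝ}
  (ℓ : P →L[ℝ] Q →L[ℝ] ℝ) (π : Q →L[ℝ] ℝ)

theorem integrable_cosWave_smul_add_sincWave_smul (ha : HasMoments μ a) (hb : HasMoments μ b)
    (hr : Continuous r) (q : Q) :
    Integrable (fun p => cosWave ℓ π r p q • a p + sincWave ℓ π r p q • b p) μ :=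
  (ha.integrable.norm.add (hb.integrable.norm.const_mul |π q|)).mono'
    (continuous_cosWave_smul_add_sincWave_smul ℓ π q ha.1 hb.1 hr).aestronglyMeasurable
    (.of_forall fun p => norm_cosWave_smul_add_sincWave_smul_le ℓ π r p q a b)

variable [NormedSpace ℝ E]

theorem integrable_sq_smul_cosWave_smul_add_sincWave_smul (ha : HasMoments μ a)
    (hb : HasMoments μ b) (hr : Continuous r) (q v : Q) :
    Integrable (fun p => (-(ℓ p v) ^ 2) •
      (cosWave ℓ π r p q • a p + sincWave ℓ π r p q • b p)) μ := by
  have hK := continuous_cosWave_smul_add_sincWave_smul ℓ π q ha.1 hb.1 hr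
  have hc : Continuous fun p => (-(ℓ p v) ^ 2) •
      (cosWave ℓ π r p q • a p + sincWave ℓ π r p q • b p) := by fun_prop
  refine (((ha.2 2).add ((hb.2 2).const_mul |π q|)).const_mul ((‖ℓ‖ * ‖v‖) ^ 2)).mono'
    hc.aestronglyMeasurable (.of_forall fun p => ?_)
  rw [norm_smul, norm_neg, norm_pow, Pi.add_apply]
  calc ‖ℓ p v‖ ^ 2 * ‖cosWave ℓ π r p q • a p + sincWave ℓ π r p q • b p‖
      ≤ (‖ℓ‖ * ‖p‖ * ‖v‖) ^ 2 * (‖a p‖ + |π q| * ‖b p‖) := by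
        gcongr
        · exact ℓ.le_opNorm₂ p v
        · exact norm_cosWave_smul_add_sincWave_smul_le ℓ π r p q a b
    _ = _ := by ring

variable [IsScalarTower ℝ ℂ E]

theorem hasFDerivAt_waveSynthesis (ha : HasMoments μ a) (hb : HasMoments μ b)
    (hr : Continuous r) (hr' : ∀ p, |r p| ≤ ‖p‖) (q : Q) :
    HasFDerivAt (waveSynthesis μ ℓ π r a b)
      (waveSynthesis μ ℓ π r (cosAmplitude ℓ π a b) (sincAmplitude ℓ π r a b) q) q := by
  have ha' := ha.cosAmplitude hb ℓ π
  have hb' := ha.sincAmplitude hb ℓ π hr hr'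
  have hnhds : {x | |π x| < |π q| + 1} ∈ nhds q :=
    (isOpen_lt (by fun_prop) continuous_const).mem_nhds (by simp)
  refine hasFDerivAt_integral_of_dominated_of_fderiv_le
    (bound := fun p => ‖cosAmplitude ℓ π a b p‖ + (|π q| + 1) * ‖sincAmplitude ℓ π r a b p‖) hnhds
    (.of_forall fun x =>
      (continuous_cosWave_smul_add_sincWave_smul ℓ π x ha.1 hb.1 hr).aestronglyMeasurable)
    (integrable_cosWave_smul_add_sincWave_smul ℓ π ha hb hr q)
    (continuous_cosWave_smul_add_sincWave_smul ℓ π q ha'.1 hb'.1 hr).aestronglyMeasurable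
    (.of_forall fun p x hx => ?_)
    (ha'.integrable.norm.add (hb'.integrable.norm.const_mul _))
    (.of_forall fun p x _ => hasFDerivAt_cosWave_smul_add_sincWave_smul ℓ π r p x a b)
  refine (norm_cosWave_smul_add_sincWave_smul_le ℓ π r p x _ _).trans ?_
  gcongr
  exact le_of_lt hx

theorem fderiv_waveSynthesis_apply (ha : HasMoments μ a) (hb : HasMoments μ b)
    (hr : Continuous r) (hr' : ∀ p, |r p| ≤ ‖p‖) (q v : Q) :
    fderiv ℝ (waveSynthesis μ ℓ π r a b) q v =
      waveSynthesis μ ℓ π r (fun p => cosAmplitude ℓ π a b p v)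
        (fun p => sincAmplitude ℓ π r a b p v) q := by
  rw [(hasFDerivAt_waveSynthesis ℓ π ha hb hr hr' q).fderiv, waveSynthesis,
    ContinuousLinearMap.integral_apply (integrable_cosWave_smul_add_sincWave_smul ℓ π
      (ha.cosAmplitude hb ℓ π) (ha.sincAmplitude hb ℓ π hr hr') hr q)]
  rfl

theorem fderiv_fderiv_waveSynthesis_apply (ha : HasMoments μ a) (hb : HasMoments μ b)
    (hr : Continuous r) (hr' : ∀ p, |r p| ≤ ‖p‖) (q v : Q) :
    fderiv ℝ (fun x => fderiv ℝ (waveSynthesis μ ℓ π r a b) x v) q v =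
      ∫ p, (cosWave ℓ π r p q •
          ((-(ℓ p v) ^ 2 - π v ^ 2 * r p ^ 2) • a p + (2 * π v * ℓ p v) • Complex.I • b p) +
        sincWave ℓ π r p q • ((-(ℓ p v) ^ 2 - π v ^ 2 * r p ^ 2) • b p -
          (2 * π v * ℓ p v * r p ^ 2) • Complex.I • a p)) ∂μ := by
  simp_rw [fderiv_waveSynthesis_apply ℓ π ha hb hr hr' _ v]
  change fderiv ℝ (waveSynthesis μ ℓ π r _ _) q v = _
  rw [fderiv_waveSynthesis_apply ℓ π ((ha.cosAmplitude hb ℓ π).apply v)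
    ((ha.sincAmplitude hb ℓ π hr hr').apply v) hr hr']
  refine integral_congr_ae (.of_forall fun p => ?_)
  simp only [cosAmplitude, sincAmplitude, add_apply,
    sub_apply, ContinuousLinearMap.smulRight_apply,
    ← algebraMap_smul ℂ (_ : ℝ) (_ : E), Complex.coe_algebraMap]
  push_cast
  match_scalars
  · linear_combination cosWave ℓ π r p q * (ℓ p v : ℂ) ^ 2 * Complex.I_sq
  · linear_combination sincWave ℓ π r p q * (ℓ p v : ℂ) ^ 2 * Complex.I_sq

theorem fderiv_fderiv_waveSynthesis_apply_of_eq_zero (ha : HasMoments μ a) (hb : HasMoments μ b)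
    (hr : Continuous r) (hr' : ∀ p, |r p| ≤ ‖p‖) (q : Q) {v : Q} (hv : π v = 0) :
    fderiv ℝ (fun x => fderiv ℝ (waveSynthesis μ ℓ π r a b) x v) q v =
      ∫ p, (-(ℓ p v) ^ 2) • (cosWave ℓ π r p q • a p + sincWave ℓ π r p q • b p) ∂μ := by
  rw [fderiv_fderiv_waveSynthesis_apply ℓ π ha hb hr hr']
  refine integral_congr_ae (.of_forall fun p => ?_)
  simp only [hv, ← algebraMap_smul ℂ (_ : ℝ) (_ : E), Complex.coe_algebraMap]
  push_cast
  module

theorem fderiv_fderiv_waveSynthesis_apply_of_forall_eq_zero (ha : HasMoments μ a)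
    (hb : HasMoments μ b) (hr : Continuous r) (hr' : ∀ p, |r p| ≤ ‖p‖) (q : Q) {v : Q}
    (hv : ∀ p, ℓ p v = 0) :
    fderiv ℝ (fun x => fderiv ℝ (waveSynthesis μ ℓ π r a b) x v) q v =
      ∫ p, (-(π v ^ 2 * r p ^ 2)) • (cosWave ℓ π r p q • a p + sincWave ℓ π r p q • b p) ∂μ := by
  rw [fderiv_fderiv_waveSynthesis_apply ℓ π ha hb hr hr']
  refine integral_congr_ae (.of_forall fun p => ?_)
  simp only [hv, ← algebraMap_smul ℂ (_ : ℝ) (_ : E), Complex.coe_algebraMap]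
  push_cast
  module

end Synthesis

theorem contDiff_waveSynthesis {P Q : Type} [NormedAddCommGroup P] [NormedSpace ℝ P]
    [NormedAddCommGroup Q] [NormedSpace ℝ Q] [MeasurableSpace P] [BorelSpace P]
    [SecondCountableTopology P] {μ : Measure P} {r : P → ℝ} (ℓ : P →L[ℝ] Q →L[ℝ] ℝ)
    (π : Q →L[ℝ] ℝ) (hr : Continuous r) (hr' : ∀ p, |r p| ≤ ‖p‖) (n : ℕ) {E : Type}
    [NormedAddCommGroup E] [NormedSpace ℂ E] [NormedSpace ℝ E] [IsScalarTower ℝ ℂ E]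
    {a b : P → E} (ha : HasMoments μ a) (hb : HasMoments μ b) :
    ContDiff ℝ n (waveSynthesis μ ℓ π r a b) := by
  induction n generalizing E with
  | zero =>
    exact contDiff_zero.2 (continuous_iff_continuousAt.2 fun q =>
      (hasFDerivAt_waveSynthesis ℓ π ha hb hr hr' q).continuousAt)
  | succ n ih =>
    exact contDiff_succ_iff_hasFDerivAt.2 ⟨_, ih (ha.cosAmplitude hb ℓ π)
      (ha.sincAmplitude hb ℓ π hr hr'), hasFDerivAt_waveSynthesis ℓ π ha hb hr hr'⟩

theorem SchwartzMap.hasMoments {P E : Type*} [NormedAddCommGroup P] [NormedSpace ℝ P]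
    [NormedAddCommGroup E] [NormedSpace ℝ E] [MeasurableSpace P] [BorelSpace P]
    [SecondCountableTopology P] (μ : Measure P) [μ.HasTemperateGrowth] (f : SchwartzMap P E) :
    HasMoments μ f :=
  ⟨f.continuous, f.integrable_pow_mul μ⟩

end WaveSynthesis

/-- The pairing `((ξ, η), (x, y, z)) ↦ ⟪ξ, x⟫ + ⟪η, z⟫`. -/
noncomputable def spacePairing (V W : Type*) [NormedAddCommGroup V] [InnerProductSpace ℝ V]
    [NormedAddCommGroup W] [InnerProductSpace ℝ W] :
    (V × W) →L[ℝ] (V × ℝ × W) →L[ℝ] ℝ :=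
  ((ContinuousLinearMap.compL ℝ (V × ℝ × W) V ℝ).flip (.fst ℝ V (ℝ × W))).comp
      ((innerSL ℝ).comp (.fst ℝ V W)) +
    ((ContinuousLinearMap.compL ℝ (V × ℝ × W) W ℝ).flip
      ((ContinuousLinearMap.snd ℝ ℝ W).comp (.snd ℝ V (ℝ × W)))).comp
      ((innerSL ℝ).comp (.snd ℝ V W))

theorem spacePairing_apply {V W : Type*} [NormedAddCommGroup V] [InnerProductSpace ℝ V]
    [NormedAddCommGroup W] [InnerProductSpace ℝ W] (p : V × W) (q : V × ℝ × W) :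
    spacePairing V W p q = ⟪p.1, q.1⟫ + ⟪p.2, q.2.2⟫ := rfl

/-- Theorem 2 of the paper (existence on the center subspace `X^C`), via explicit
Fourier synthesis: for Schwartz data `(a, b)` with Fourier support in the closed cone
`{|η'| ≤ |ξ|}`, the function `u` given by the Fourier synthesis with the entire
functions `C(s,y) = Σ (-1)ⁿ sⁿ y^{2n}/(2n)!` and `S(s,y) = Σ (-1)ⁿ sⁿ y^{2n+1}/(2n+1)!`
is a smooth global solution of the ultrahyperbolic equation `∂²_{y₁}u = Δ_x u - Δ_{y'}u`
attaining the prescribed Cauchy data at `y₁ = 0`. -/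
theorem fourier_synthesis_global_solution
    (d₁ d₂ : ℕ) (hd₁ : 1 ≤ d₁) (hd₂ : 1 ≤ d₂)
    (a b : SchwartzMap (EuclideanSpace ℝ (Fin d₁) × EuclideanSpace ℝ (Fin (d₂ - 1))) ℂ)
    (hasupp : ∀ p : EuclideanSpace ℝ (Fin d₁) × EuclideanSpace ℝ (Fin (d₂ - 1)),
      ‖p.1‖ < ‖p.2‖ → a p = 0)
    (hbsupp : ∀ p : EuclideanSpace ℝ (Fin d₁) × EuclideanSpace ℝ (Fin (d₂ - 1)),
      ‖p.1‖ < ‖p.2‖ → b p = 0)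
    (C S : ℝ → ℝ → ℝ)
    (hC : ∀ s y, C s y = ∑' n : ℕ, (-1) ^ n * s ^ n * y ^ (2 * n) / (Nat.factorial (2 * n)))
    (hS : ∀ s y, S s y = ∑' n : ℕ,
      (-1) ^ n * s ^ n * y ^ (2 * n + 1) / (Nat.factorial (2 * n + 1)))
    (u : EuclideanSpace ℝ (Fin d₁) × ℝ × EuclideanSpace ℝ (Fin (d₂ - 1)) → ℂ)
    (hu : ∀ (x : EuclideanSpace ℝ (Fin d₁)) (y₁ : ℝ)
        (y' : EuclideanSpace ℝ (Fin (d₂ - 1))),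
      u (x, y₁, y') = ((2 * Real.pi) ^ (-((d₁ + d₂ - 1 : ℕ) : ℝ) / 2) : ℝ)
        * ∫ p : EuclideanSpace ℝ (Fin d₁) × EuclideanSpace ℝ (Fin (d₂ - 1)),
            Complex.exp (Complex.I * ((⟪p.1, x⟫ + ⟪p.2, y'⟫ : ℝ) : ℂ))
              * ((C (‖p.1‖ ^ 2 - ‖p.2‖ ^ 2) y₁ : ℝ) * a p
                + (S (‖p.1‖ ^ 2 - ‖p.2‖ ^ 2) y₁ : ℝ) * b p)) :
    ContDiff ℝ (⊤ : ℕ∞) u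
    ∧ (∀ p : EuclideanSpace ℝ (Fin d₁) × ℝ × EuclideanSpace ℝ (Fin (d₂ - 1)),
        fderiv ℝ (fun q => fderiv ℝ u q (0, 1, 0)) p (0, 1, 0)
          = (∑ i : Fin d₁,
              fderiv ℝ (fun q => fderiv ℝ u q (EuclideanSpace.single i 1, 0, 0)) p
                (EuclideanSpace.single i 1, 0, 0))
            - ∑ j : Fin (d₂ - 1),
              fderiv ℝ (fun q => fderiv ℝ u q (0, 0, EuclideanSpace.single j 1)) p
                (0, 0, EuclideanSpace.single j 1))
    ∧ (∀ (x : EuclideanSpace ℝ (Fin d₁)) (y' : EuclideanSpace ℝ (Fin (d₂ - 1))),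
        u (x, 0, y') = ((2 * Real.pi) ^ (-((d₁ + d₂ - 1 : ℕ) : ℝ) / 2) : ℝ)
          * ∫ p : EuclideanSpace ℝ (Fin d₁) × EuclideanSpace ℝ (Fin (d₂ - 1)),
              Complex.exp (Complex.I * ((⟪p.1, x⟫ + ⟪p.2, y'⟫ : ℝ) : ℂ)) * a p)
    ∧ (∀ (x : EuclideanSpace ℝ (Fin d₁)) (y' : EuclideanSpace ℝ (Fin (d₂ - 1))),
        fderiv ℝ u (x, 0, y') (0, 1, 0)
          = ((2 * Real.pi) ^ (-((d₁ + d₂ - 1 : ℕ) : ℝ) / 2) : ℝ)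
            * ∫ p : EuclideanSpace ℝ (Fin d₁) × EuclideanSpace ℝ (Fin (d₂ - 1)),
                Complex.exp (Complex.I * ((⟪p.1, x⟫ + ⟪p.2, y'⟫ : ℝ) : ℂ)) * b p) := by
  set c : ℝ := (2 * Real.pi) ^ (-((d₁ + d₂ - 1 : ℕ) : ℝ) / 2)
  let ℓ := spacePairing (EuclideanSpace ℝ (Fin d₁)) (EuclideanSpace ℝ (Fin (d₂ - 1)))
  let π : (EuclideanSpace ℝ (Fin d₁) × ℝ × EuclideanSpace ℝ (Fin (d₂ - 1))) →L[ℝ] ℝ :=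
    (ContinuousLinearMap.fst ℝ ℝ _).comp (.snd ℝ _ _)
  let r : EuclideanSpace ℝ (Fin d₁) × EuclideanSpace ℝ (Fin (d₂ - 1)) → ℝ := fun p =>
    √(‖p.1‖ ^ 2 - ‖p.2‖ ^ 2)
  have hr : Continuous r := by fun_prop
  have hr' (p) : |r p| ≤ ‖p‖ := by
    rw [abs_of_nonneg (Real.sqrt_nonneg _)]
    refine Real.sqrt_le_left (norm_nonneg p) |>.2 ?_
    have := pow_le_pow_left₀ (norm_nonneg _) (norm_fst_le p) 2
    nlinarith [sq_nonneg ‖p.2‖]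
  have : (volume : Measure
      (EuclideanSpace ℝ (Fin d₁) × EuclideanSpace ℝ (Fin (d₂ - 1)))).IsAddHaarMeasure :=
    Measure.prod.instIsAddHaarMeasure _ _
  have ha := (c • a).hasMoments volume
  have hb := (c • b).hasMoments volume
  have hcone p : 0 ≤ ‖p.1‖ ^ 2 - ‖p.2‖ ^ 2 ∨ (a p = 0 ∧ b p = 0) := by
    rcases le_or_gt ‖p.2‖ ‖p.1‖ with h | h
    · exact .inl (sub_nonneg.2 (pow_le_pow_left₀ (norm_nonneg _) h 2))
    · exact .inr ⟨hasupp p h, hbsupp p h⟩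
  have hu' : u = waveSynthesis volume ℓ π r ⇑(c • a) ⇑(c • b) := by
    ext ⟨x, y, z⟩
    rw [hu, waveSynthesis, ← integral_const_mul]
    refine integral_congr_ae (.of_forall fun p => ?_)
    rcases hcone p with h | ⟨h1, h2⟩
    · simp only [hC, hS, tsum_cos_sqrt h, tsum_sin_sqrt h]
      simp only [cosWave, sincWave, smul_apply, Complex.real_smul, smul_eq_mul]
      change _ * (Complex.exp (Complex.I * ((ℓ p (x, y, z) : ℝ) : ℂ)) * _) = _
      simp only [π, r, ContinuousLinearMap.comp_apply, ContinuousLinearMap.coe_snd',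
        ContinuousLinearMap.coe_fst']
      ring
    · simp [h1, h2]
  refine ⟨?_, fun q => ?_, fun x z => ?_, fun x z => ?_⟩
  · rw [hu']
    exact contDiff_infty.2 fun n => contDiff_waveSynthesis ℓ π hr hr' n ha hb
  · have hℓ₁ (p) : ℓ p (0, 1, 0) = 0 := by simp [ℓ, spacePairing_apply]
    have hℓ₂ (i : Fin d₁) (p) : ℓ p (EuclideanSpace.single i 1, 0, 0) = p.1 i := by
      simp [ℓ, spacePairing_apply, EuclideanSpace.inner_single_right]
    have hℓ₃ (j : Fin (d₂ - 1)) (p) :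
        ℓ p (0, 0, EuclideanSpace.single j 1) = p.2 j := by
      simp [ℓ, spacePairing_apply, EuclideanSpace.inner_single_right]
    have hint := integrable_sq_smul_cosWave_smul_add_sincWave_smul ℓ π ha hb hr q
    rw [hu', fderiv_fderiv_waveSynthesis_apply_of_forall_eq_zero ℓ π ha hb hr hr' q hℓ₁]
    simp_rw [fun i => fderiv_fderiv_waveSynthesis_apply_of_eq_zero ℓ π ha hb hr hr' q
        (v := (EuclideanSpace.single i 1, 0, 0)) rfl,
      fun j => fderiv_fderiv_waveSynthesis_apply_of_eq_zero ℓ π ha hb hr hr' q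
        (v := (0, 0, EuclideanSpace.single j 1)) rfl]
    rw [← integral_finsetSum _ fun i _ => hint _, ← integral_finsetSum _ fun j _ => hint _,
      ← integral_sub (integrable_finsetSum _ fun i _ => hint _)
        (integrable_finsetSum _ fun j _ => hint _)]
    refine integral_congr_ae (.of_forall fun p => ?_)
    rcases hcone p with h | ⟨h1, h2⟩
    · simp only [hℓ₂, hℓ₃]
      rw [← Finset.sum_smul, ← Finset.sum_smul, ← sub_smul]
      congr 1
      rw [Real.sq_sqrt h, EuclideanSpace.real_norm_sq_eq, EuclideanSpace.real_norm_sq_eq]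
      simp [π]
      ring
    · simp [h1, h2]
  · rw [hu', waveSynthesis, ← integral_const_mul]
    refine integral_congr_ae (.of_forall fun p => ?_)
    simp [cosWave, sincWave, π, ℓ, spacePairing_apply]
    ring
  · rw [hu', fderiv_waveSynthesis_apply ℓ π ha hb hr hr', waveSynthesis, ← integral_const_mul]
    refine integral_congr_ae (.of_forall fun p => ?_)
    simp [cosWave, sincWave, cosAmplitude, π, ℓ, spacePairing_apply]
    ring
end

section
/- Let d₁ ≥ 1, d₂ ≥ 2, and k ∈ ℕ. There exists a Schwartz function u₀ : ℝ^{d₁} × ℝ^{d₂-1} → ℂ, not identically zero, such that: (i) the Fourier transform of u₀ is supported in the cone {(ξ, η') : |η'| < |ξ|} (so the pair (u₀, 0) is constraint-satisfying Cauchy data on N giving a globally defined solution), and (ii) every partial derivative of u₀ of total order at most k vanishes identically on the subset M = {(x, y') : y' = 0}; i.e., ∂_x^α ∂_{y'}^β u₀(x, 0) = 0 for all x ∈ ℝ^{d₁} and all multi-indices with |α| + |β| ≤ k. -/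
open MeasureTheory RealInnerProductSpace

open scoped ContDiff SchwartzMap FourierTransform LineDeriv

/-- If `l` vanishes at `x`, then `l ^ N • f` vanishes at `x` together with its derivatives of order
less than `N`. -/
lemma iteratedFDeriv_pow_smul_eq_zero {E : Type*} [NormedAddCommGroup E] [NormedSpace ℝ E]
    {l f : E → ℂ} (hl : ContDiff ℝ ∞ l) (hf : ContDiff ℝ ∞ f) {x : E} (hx : l x = 0)
    {N n : ℕ} (hn : n < N) : iteratedFDeriv ℝ n (fun y => l y ^ N • f y) x = 0 := by
  induction N generalizing n with
  | zero => omega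
  | succ N ih =>
    have heq : (fun y => l y ^ (N + 1) • f y) = fun y => l y • (l y ^ N • f y) := by
      ext y
      simp only [smul_eq_mul]
      ring
    rw [heq, ← norm_le_zero_iff]
    refine (norm_iteratedFDeriv_smul_le hl ((hl.pow N).smul hf) x
      (mod_cast le_top : (n : ℕ∞ω) ≤ ∞)).trans (Finset.sum_nonpos fun i hi => ?_)
    rcases Nat.eq_zero_or_pos i with rfl | hi0
    · simp [hx]
    · rw [Finset.mem_range] at hi
      have hzero : iteratedFDeriv ℝ (n - i) ((fun y => l y ^ N) • f) x = 0 :=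
        ih (by omega : n - i < N)
      rw [hzero]
      simp

/-- A continuous function vanishing off the hyperplane orthogonal to `m ≠ 0` vanishes. -/
lemma eq_zero_of_forall_inner_ne_zero {V : Type*} [NormedAddCommGroup V] [InnerProductSpace ℝ V]
    {f : V → ℂ} (hf : Continuous f) {m : V} (hm : m ≠ 0)
    (h : ∀ x : V, (⟪x, m⟫ : ℝ) ≠ 0 → f x = 0) : f = 0 := by
  have hne : (innerSL ℝ m : V →L[ℝ] ℝ) ≠ 0 := by
    intro h0
    have := DFunLike.congr_fun h0 m
    simp [hm] at this
  have hd : Dense ((innerSL ℝ m : V →L[ℝ] ℝ) ⁻¹' {0}ᶜ) :=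
    (dense_compl_singleton (0 : ℝ)).preimage
      (ContinuousLinearMap.isOpenMap_of_ne_zero _ hne)
  refine Continuous.ext_on hd hf continuous_const fun x hx => h x ?_
  rw [real_inner_comm]
  simpa using hx

section Fourier

variable {V : Type*} [NormedAddCommGroup V] [InnerProductSpace ℝ V] [FiniteDimensional ℝ V]
  [MeasurableSpace V] [BorelSpace V]

/-- The inverse Fourier transform turns iterated derivatives in direction `m` into powers of
the linear function `⟪·, m⟫`. -/
lemma SchwartzMap.fourierInv_iteratedLineDerivOp_const_apply (f : 𝓢(V, ℂ)) (m : V) (n : ℕ)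
    (x : V) : 𝓕⁻ (∂^{fun _ : Fin n => m} f) x
      = (-(2 * Real.pi * Complex.I) * (⟪x, m⟫ : ℝ)) ^ n • 𝓕⁻ f x := by
  induction n with
  | zero => simp
  | succ n ih =>
    have hg : (inner ℝ · m : V → ℝ).HasTemperateGrowth := by fun_prop
    rw [LineDeriv.iteratedLineDerivOp_succ_left, SchwartzMap.fourierInv_lineDerivOp_eq]
    have htail : Fin.tail (fun _ : Fin (n + 1) => m) = fun _ : Fin n => m := rfl
    rw [htail, smul_apply, SchwartzMap.smulLeftCLM_apply_apply hg, ih]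
    simp only [smul_eq_mul, Complex.real_smul]
    ring

end Fourier

/-- A nonempty open set contains the support of some nonzero Schwartz function. -/
lemma SchwartzMap.exists_ne_zero_tsupport_subset {V : Type*} [NormedAddCommGroup V]
    [InnerProductSpace ℝ V] [FiniteDimensional ℝ V] {U : Set V} (hU : IsOpen U) {c : V}
    (hc : c ∈ U) : ∃ b : 𝓢(V, ℂ), b ≠ 0 ∧ tsupport b ⊆ U := by
  obtain ⟨f, hfU, hfc, hfs, -, hf1⟩ :=
    exists_contDiff_tsupport_subset (n := (⊤ : ℕ∞)) (hU.mem_nhds hc)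
  have hsub : tsupport (fun x => (f x : ℂ)) ⊆ tsupport f :=
    closure_mono fun x hx => by simpa using hx
  have hcs : HasCompactSupport fun x => (f x : ℂ) := hfc.of_isClosed_subset
    (isClosed_tsupport _) hsub
  refine ⟨hcs.toSchwartzMap (Complex.ofRealCLM.contDiff.comp hfs), fun h => ?_, hsub.trans hfU⟩
  have hc0 : (f c : ℂ) = 0 := DFunLike.congr_fun h c
  simp [hf1] at hc0

section Product

variable {E F : Type*} [NormedAddCommGroup E] [InnerProductSpace ℝ E] [FiniteDimensional ℝ E]
  [MeasurableSpace E] [BorelSpace E] [NormedAddCommGroup F] [InnerProductSpace ℝ F]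
  [FiniteDimensional ℝ F] [MeasurableSpace F] [BorelSpace F]

/-- The Fourier integral on `E × F` with angular frequency is the Fourier transform on the
`L²`-product evaluated at the rescaled frequency. -/
lemma integral_prod_exp_mul_eq_fourier (g : WithLp 2 (E × F) → ℂ) (ζ : E × F) :
    ∫ p : E × F, Complex.exp (-(Complex.I * ((⟪p.1, ζ.1⟫ + ⟪p.2, ζ.2⟫ : ℝ) : ℂ)))
        * g (WithLp.toLp 2 p)
      = 𝓕 g (WithLp.toLp 2 ((2 * Real.pi)⁻¹ • ζ)) := by
  rw [Real.fourier_eq', ← (WithLp.volume_preserving_toLp E F).integral_comp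
    (MeasurableEquiv.toLp 2 (E × F)).measurableEmbedding]
  refine integral_congr_ae (Filter.Eventually.of_forall fun p => ?_)
  have hpi : (Real.pi : ℂ) ≠ 0 := mod_cast Real.pi_ne_zero
  simp only [WithLp.prod_inner_apply, Prod.smul_fst, Prod.smul_snd, inner_smul_right, smul_eq_mul]
  congr 2
  push_cast
  field_simp

end Product

/-- Theorem 10 of the paper (failure of uniqueness in higher codimension): for any
`k`, there exist nonzero Schwartz Cauchy data `u₀` on `N = {y₁ = 0}` whose Fourier
transform is supported in the constraint cone `{|η'| < |ξ|}` and all of whose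
derivatives of total order at most `k` vanish identically on the spacelike
hypersurface `M = {(x, y') : y' = 0}`. -/
theorem exists_constraint_data_vanishing_to_order_k
    (d₁ d₂ : ℕ) (hd₁ : 1 ≤ d₁) (hd₂ : 2 ≤ d₂) (k : ℕ) :
    ∃ u₀ : SchwartzMap (EuclideanSpace ℝ (Fin d₁) × EuclideanSpace ℝ (Fin (d₂ - 1))) ℂ,
      (⇑u₀ ≠ 0)
      ∧ (∀ ζ : EuclideanSpace ℝ (Fin d₁) × EuclideanSpace ℝ (Fin (d₂ - 1)),
          ¬ ‖ζ.2‖ < ‖ζ.1‖ →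
          (∫ p : EuclideanSpace ℝ (Fin d₁) × EuclideanSpace ℝ (Fin (d₂ - 1)),
            Complex.exp (-(Complex.I * ((⟪p.1, ζ.1⟫ + ⟪p.2, ζ.2⟫ : ℝ) : ℂ))) * u₀ p) = 0)
      ∧ (∀ n : ℕ, n ≤ k → ∀ x : EuclideanSpace ℝ (Fin d₁),
          iteratedFDeriv ℝ n (⇑u₀) (x, 0) = 0) := by
  set E := EuclideanSpace ℝ (Fin d₁)
  set F := EuclideanSpace ℝ (Fin (d₂ - 1))
  have : Nonempty (Fin d₁) := ⟨⟨0, hd₁⟩⟩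
  have : Nonempty (Fin (d₂ - 1)) := ⟨⟨0, by omega⟩⟩
  obtain ⟨e, he⟩ := exists_ne (0 : E)
  obtain ⟨e', he'⟩ := exists_ne (0 : F)
  let T : (E × F) ≃L[ℝ] WithLp 2 (E × F) := (WithLp.prodContinuousLinearEquiv 2 ℝ E F).symm
  let m : WithLp 2 (E × F) := WithLp.toLp 2 (0, e')
  have hm : m ≠ 0 := fun h => he' (congrArg WithLp.snd h)
  have hU : IsOpen {w : WithLp 2 (E × F) | ‖w.snd‖ < ‖w.fst‖} :=
    isOpen_lt (by fun_prop) (by fun_prop)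
  obtain ⟨b, hb0, hbU⟩ := SchwartzMap.exists_ne_zero_tsupport_subset hU
    (c := WithLp.toLp 2 (e, 0)) (by change ‖(0 : F)‖ < ‖e‖; rw [norm_zero]; exact norm_pos_iff.2 he)
  let D : 𝓢(WithLp 2 (E × F), ℂ) := ∂^{fun _ : Fin (k + 1) => m} b
  have hval : ∀ x, 𝓕⁻ D x = (-(2 * Real.pi * Complex.I) * (⟪x, m⟫ : ℝ)) ^ (k + 1) • 𝓕⁻ b x :=
    SchwartzMap.fourierInv_iteratedLineDerivOp_const_apply b m (k + 1)
  refine ⟨SchwartzMap.compCLMOfContinuousLinearEquiv ℂ T (𝓕⁻ D), fun h => hb0 ?_,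
    fun ζ hζ => ?_, fun n hn x => ?_⟩
  · have hF : 𝓕⁻ b = 0 := by
      refine DFunLike.coe_injective (eq_zero_of_forall_inner_ne_zero (𝓕⁻ b).continuous hm
        fun x hx => ?_)
      have h1 := congrFun h (T.symm x)
      rw [SchwartzMap.compCLMOfContinuousLinearEquiv_apply, Function.comp_apply,
        T.apply_symm_apply, hval] at h1
      have hx' : ((⟪x, m⟫ : ℝ) : ℂ) ≠ 0 := mod_cast hx
      refine (smul_eq_zero.1 h1).resolve_left (pow_ne_zero _ (mul_ne_zero ?_ hx'))
      simp [Real.pi_ne_zero]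
    rw [← FourierTransform.fourier_fourierInv_eq (F := 𝓢(WithLp 2 (E × F), ℂ)) b, hF]
    exact map_zero (SchwartzMap.fourierTransformCLM ℂ)
  · have h2 := integral_prod_exp_mul_eq_fourier (⇑(𝓕⁻ D : 𝓢(WithLp 2 (E × F), ℂ))) ζ
    rw [← SchwartzMap.fourier_coe, FourierTransform.fourier_fourierInv_eq] at h2
    refine h2.trans (image_eq_zero_of_notMem_tsupport fun hmem => hζ ?_)
    have h3 := hbU (SchwartzMap.tsupport_iteratedLineDerivOp_subset _ _ hmem)
    simpa [norm_smul, Real.pi_ne_zero] using h3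
  · have heq : ⇑(SchwartzMap.compCLMOfContinuousLinearEquiv ℂ T (𝓕⁻ D)) = fun p =>
        (-(2 * Real.pi * Complex.I) * (⟪T p, m⟫ : ℝ)) ^ (k + 1) • 𝓕⁻ b (T p) :=
      funext fun p => hval (T p)
    rw [heq]
    refine iteratedFDeriv_pow_smul_eq_zero ?_ (((𝓕⁻ b).smooth ⊤).comp T.contDiff) ?_
      (Nat.lt_succ_of_le hn)
    · exact contDiff_const.mul (Complex.ofRealCLM.contDiff.comp
        (T.contDiff.inner ℝ contDiff_const))
    · simp [T, m]
end
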